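/- Let 0 < Y < 1 and M > 1. Then ∫_{0}^{∞} (e^{z} − 1 − z) e^{-Mz} z^{-(1+Y)} dz = Γ(−Y) · ((M−1)^{Y} − M^{Y} + Y·M^{Y−1}), where Γ denotes the Gamma function extended to negative non-integer arguments. (This is the positive-jump contribution to the exponential compensator ∫_ℝ (e^{z} − 1 − z) ν(dz) of the CGMY process.) -/

import Mathlib

open MeasureTheory Real

theorem integrableOn_rpow_mul_exp_neg_mul_Ioi {s b : ℝ} (hs : -1 < s) (hb : 0 < b) :
    IntegrableOn (fun z : ℝ => z ^ s * exp (-b * z)) (Set.Ioi 0) := by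
  simpa using integrableOn_rpow_mul_exp_neg_mul_rpow hs one_pos hb

theorem exp_neg_mul_sub_exp_neg_mul_nonneg {a b z : ℝ} (hab : a ≤ b) (hz : 0 ≤ z) :
    0 ≤ exp (-a * z) - exp (-b * z) := by
  rw [sub_nonneg, exp_le_exp]
  nlinarith

theorem exp_neg_mul_sub_exp_neg_mul_le (a b z : ℝ) :
    exp (-a * z) - exp (-b * z) ≤ (b - a) * z * exp (-a * z) := by
  have h : exp (-b * z) = exp (-a * z) * exp (-((b - a) * z)) := by
    rw [← exp_add]
    ring_nf
  rw [h]
  nlinarith [add_one_le_exp (-((b - a) * z)), exp_pos (-a * z)]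

theorem integrableOn_exp_neg_mul_sub_exp_neg_mul_mul_rpow {a b Y : ℝ} (ha : 0 < a) (hab : a ≤ b)
    (hY : Y < 1) :
    IntegrableOn (fun z : ℝ => (exp (-a * z) - exp (-b * z)) * z ^ (-Y - 1)) (Set.Ioi 0) := by
  refine Integrable.mono'
    ((integrableOn_rpow_mul_exp_neg_mul_Ioi (s := -Y) (by linarith) ha).const_mul (b - a))
    (by fun_prop) ?_
  filter_upwards [ae_restrict_mem measurableSet_Ioi] with z (hz : 0 < z)
  have hp : 0 < z ^ (-Y - 1) := rpow_pos_of_pos hz _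
  rw [norm_of_nonneg (mul_nonneg (exp_neg_mul_sub_exp_neg_mul_nonneg hab hz.le) hp.le)]
  calc _ ≤ (b - a) * z * exp (-a * z) * z ^ (-Y - 1) := by
        gcongr
        exact exp_neg_mul_sub_exp_neg_mul_le a b z
    _ = _ := by
        rw [rpow_sub_one hz.ne']
        field_simp

theorem tendsto_exp_neg_mul_sub_exp_neg_mul_mul_rpow {a b Y : ℝ} (hab : a ≤ b)
    {l : Filter ℝ} (hl : ∀ᶠ z in l, 0 < z)
    (h : Filter.Tendsto (fun z : ℝ => z ^ (1 - Y) * exp (-a * z)) l (nhds 0)) :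
    Filter.Tendsto (fun z : ℝ => (exp (-a * z) - exp (-b * z)) * z ^ (-Y)) l (nhds 0) := by
  refine squeeze_zero' (hl.mono fun z hz => ?_) (hl.mono fun z hz => ?_)
    (by simpa using h.const_mul (b - a))
  · exact mul_nonneg (exp_neg_mul_sub_exp_neg_mul_nonneg hab hz.le) (rpow_nonneg hz.le _)
  · calc _ ≤ (b - a) * z * exp (-a * z) * z ^ (-Y) := by
          gcongr
          exact exp_neg_mul_sub_exp_neg_mul_le a b z
      _ = _ := by
          rw [sub_eq_neg_add 1 Y, rpow_add_one hz.ne']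
          ring_nf

theorem integral_rpow_neg_mul_exp_neg_mul_Ioi {b Y : ℝ} (hb : 0 < b) (hY0 : Y ≠ 0) (hY1 : Y < 1) :
    ∫ z in Set.Ioi (0 : ℝ), z ^ (-Y) * exp (-b * z) = -Y * Gamma (-Y) * b ^ (Y - 1) := by
  have h := integral_rpow_mul_exp_neg_mul_Ioi (a := 1 - Y) (by linarith) hb
  simp only [← neg_mul, sub_sub_cancel_left] at h
  rw [h, sub_eq_neg_add 1 Y, Gamma_add_one (neg_ne_zero.2 hY0), one_div, inv_rpow hb.le,
    ← rpow_neg hb.le]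
  ring_nf

theorem integral_exp_neg_mul_sub_exp_neg_mul_mul_rpow {a b Y : ℝ} (ha : 0 < a) (hab : a ≤ b)
    (hY0 : 0 < Y) (hY1 : Y < 1) :
    ∫ z in Set.Ioi (0 : ℝ), (exp (-a * z) - exp (-b * z)) * z ^ (-Y - 1)
      = Gamma (-Y) * (a ^ Y - b ^ Y) := by
  have hb : 0 < b := ha.trans_le hab
  have hu : ∀ z ∈ Set.Ioi (0 : ℝ), HasDerivAt (fun z => exp (-a * z) - exp (-b * z))
      (b * exp (-b * z) - a * exp (-a * z)) z := fun z _ => by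
    have h (c : ℝ) : HasDerivAt (fun z => exp (-c * z)) (-c * exp (-c * z)) z := by
      simpa [mul_comm] using ((hasDerivAt_id z).const_mul (-c)).exp
    exact ((h a).sub (h b)).congr_deriv (by ring)
  have hv : ∀ z ∈ Set.Ioi (0 : ℝ), HasDerivAt (fun z => z ^ (-Y) * (-Y)⁻¹) (z ^ (-Y - 1)) z :=
    fun z hz =>
      ((hasDerivAt_rpow_const (p := -Y) (Or.inl (ne_of_gt hz))).mul_const (-Y)⁻¹).congr_deriv
        (by field_simp)
  have hI (c : ℝ) (hc : 0 < c) := integrableOn_rpow_mul_exp_neg_mul_Ioi (s := -Y) (by linarith) hc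
  have hsplit : ((fun z => b * exp (-b * z) - a * exp (-a * z)) * fun z => z ^ (-Y) * (-Y)⁻¹)
      = fun z : ℝ => b * (-Y)⁻¹ * (z ^ (-Y) * exp (-b * z))
        - a * (-Y)⁻¹ * (z ^ (-Y) * exp (-a * z)) := by
    ext z
    simp only [Pi.mul_apply]
    ring
  have hlim {l : Filter ℝ} (hl : ∀ᶠ z in l, 0 < z)
      (h : Filter.Tendsto (fun z : ℝ => z ^ (1 - Y) * exp (-a * z)) l (nhds 0)) :
      Filter.Tendsto ((fun z => exp (-a * z) - exp (-b * z)) * fun z => z ^ (-Y) * (-Y)⁻¹)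
        l (nhds 0) := by
    simpa [Pi.mul_def, mul_assoc] using
      (tendsto_exp_neg_mul_sub_exp_neg_mul_mul_rpow hab hl h).mul_const (-Y)⁻¹
  have hzero : Filter.Tendsto (fun z : ℝ => z ^ (1 - Y) * exp (-a * z)) (nhdsWithin 0 (Set.Ioi 0))
      (nhds 0) := by
    have hc : ContinuousAt (fun z : ℝ => z ^ (1 - Y) * exp (-a * z)) 0 :=
      (continuousAt_rpow_const _ _ (Or.inr (by linarith))).mul (by fun_prop)
    have h := hc.tendsto.mono_left (nhdsWithin_le_nhds (s := Set.Ioi 0))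
    rwa [zero_rpow (by linarith), zero_mul] at h
  have hparts := integral_Ioi_mul_deriv_eq_deriv_mul hu hv
    (integrableOn_exp_neg_mul_sub_exp_neg_mul_mul_rpow ha hab hY1)
    (hsplit ▸ ((hI b hb).const_mul _).sub ((hI a ha).const_mul _))
    (hlim self_mem_nhdsWithin hzero)
    (hlim (Filter.eventually_gt_atTop 0) (tendsto_rpow_mul_exp_neg_mul_atTop_nhds_zero _ _ ha))
  have hint : ∫ z in Set.Ioi (0 : ℝ),
      (b * exp (-b * z) - a * exp (-a * z)) * (z ^ (-Y) * (-Y)⁻¹)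
        = b * (-Y)⁻¹ * (-Y * Gamma (-Y) * b ^ (Y - 1))
          - a * (-Y)⁻¹ * (-Y * Gamma (-Y) * a ^ (Y - 1)) := by
    rw [← integral_rpow_neg_mul_exp_neg_mul_Ioi hb hY0.ne' hY1,
      ← integral_rpow_neg_mul_exp_neg_mul_Ioi ha hY0.ne' hY1, ← integral_const_mul,
      ← integral_const_mul, ← integral_sub ((hI b hb).const_mul _) ((hI a ha).const_mul _)]
    exact congrArg (fun f : ℝ → ℝ => ∫ z in Set.Ioi (0 : ℝ), f z) hsplit
  rw [hparts, hint, rpow_sub_one ha.ne', rpow_sub_one hb.ne']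
  field_simp
  ring

/-- Positive-jump contribution to the exponential compensator of the CGMY process:
for `0 < Y < 1` and `M > 1`,
`∫_0^∞ (e^z − 1 − z) e^(-Mz) z^(-(1+Y)) dz = Γ(−Y) ((M−1)^Y − M^Y + Y M^(Y−1))`. -/
theorem cgmy_positive_jump_compensator (Y M : ℝ) (hY0 : 0 < Y) (hY1 : Y < 1) (hM : 1 < M) :
    ∫ z in Set.Ioi (0:ℝ), (Real.exp z - 1 - z) * Real.exp (-M * z) * z ^ (-(1 + Y))
      = Real.Gamma (-Y) * ((M - 1) ^ Y - M ^ Y + Y * M ^ (Y - 1)) := by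
  have hM0 : 0 < M := by linarith
  have hM1 : 0 < M - 1 := by linarith
  have hle : M - 1 ≤ M := by linarith
  have hsplit : ∀ z ∈ Set.Ioi (0 : ℝ), (exp z - 1 - z) * exp (-M * z) * z ^ (-(1 + Y))
      = (exp (-(M - 1) * z) - exp (-M * z)) * z ^ (-Y - 1) - z ^ (-Y) * exp (-M * z) := by
    intro z (hz : 0 < z)
    have hexp : exp (-(M - 1) * z) = exp z * exp (-M * z) := by
      rw [← exp_add]
      ring_nf
    rw [hexp, show -(1 + Y) = -Y - 1 by ring, rpow_sub_one hz.ne']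
    field_simp
  rw [setIntegral_congr_fun measurableSet_Ioi hsplit,
    integral_sub (integrableOn_exp_neg_mul_sub_exp_neg_mul_mul_rpow hM1 hle hY1)
      (integrableOn_rpow_mul_exp_neg_mul_Ioi (by linarith) hM0),
    integral_exp_neg_mul_sub_exp_neg_mul_mul_rpow hM1 hle hY0 hY1,
    integral_rpow_neg_mul_exp_neg_mul_Ioi hM0 hY0.ne' hY1]
  ring
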